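/- For every 0 < β < 1 and every t > 0, the Wright-type transform of the cosine function satisfies ∫_0^∞ g_β(s;t) cos(s) ds = E_{2β}(−t^{2β}) = ∑_{n=0}^∞ (−1)^n t^{2nβ} / Γ(2nβ + 1). -/

import Mathlib

open MeasureTheory Real Set Filter

/-- The Wright-type density `g_β(x;t) = t^{-β} ∑_{k} (−x/t^β)^k / (k! Γ(1 − β(k+1)))`. -/
noncomputable def wrightG (β x t : ℝ) : ℝ :=
  t ^ (-β) * ∑' k : ℕ, (-x / t ^ β) ^ k / ((Nat.factorial k : ℝ) * Real.Gamma (1 - β * (k + 1)))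

/-- The two-parameter Mittag-Leffler function `E_{β,α}(z) = ∑_k z^k / Γ(βk + α)`. -/
noncomputable def mittagLeffler (β α z : ℝ) : ℝ :=
  ∑' k : ℕ, z ^ k / Real.Gamma (β * k + α)

/-- The Caputo fractional derivative of order `β ∈ (0,1)`:
`D_c^β h(t) = (1/Γ(1−β)) ∫_0^t (t−τ)^{−β} h′(τ) dτ`. -/
noncomputable def caputo (β : ℝ) (h : ℝ → ℝ) (t : ℝ) : ℝ :=
  (1 / Real.Gamma (1 - β)) * ∫ τ in (0:ℝ)..t, (t - τ) ^ (-β) * deriv h τ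

/-- A function is of exponential order on `[0,∞)` if `|h(x)| ≤ C e^{a x}` there. -/
def ExpOrder (h : ℝ → ℝ) : Prop :=
  ∃ C a : ℝ, 0 < C ∧ 0 < a ∧ ∀ x : ℝ, 0 ≤ x → |h x| ≤ C * Real.exp (a * x)

/-- A real power is dominated by an exponential of arbitrarily small rate. -/
lemma exists_rpow_le_mul_exp (p : ℝ) (hp : 0 ≤ p) {ε : ℝ} (hε : 0 < ε) :
    ∃ K : ℝ, 0 < K ∧ ∀ y : ℝ, 0 ≤ y → y ^ p ≤ K * Real.exp (ε * y) := by
  have hq : 0 < p + 1 := by linarith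
  refine ⟨((p + 1) / ε) ^ p, by positivity, fun y hy => ?_⟩
  have hz : 0 ≤ ε * y / (p + 1) := by positivity
  have h1 : y = (p + 1) / ε * (ε * y / (p + 1)) := by field_simp
  have h2 : (ε * y / (p + 1)) ^ p ≤ Real.exp (ε * y) := by
    calc (ε * y / (p + 1)) ^ p ≤ (Real.exp (ε * y / (p + 1))) ^ p := by
          gcongr
          linarith [Real.add_one_le_exp (ε * y / (p + 1))]
      _ = Real.exp (ε * y / (p + 1) * p) := (Real.exp_mul _ _).symm
      _ ≤ Real.exp (ε * y) := by
          apply Real.exp_le_exp.mpr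
          rw [div_mul_eq_mul_div, div_le_iff₀ hq]
          nlinarith [mul_nonneg hε.le hy]
  calc y ^ p = ((p + 1) / ε) ^ p * (ε * y / (p + 1)) ^ p := by
        rw [← Real.mul_rpow (by positivity) hz, ← h1]
    _ ≤ _ := by gcongr

/-- A real power of exponent less than one is dominated by a linear function of small slope. -/
lemma exists_rpow_le_add_mul {β : ℝ} (hβ0 : 0 < β) (hβ1 : β < 1) {ε : ℝ} (hε : 0 < ε) :
    ∃ K : ℝ, ∀ y : ℝ, 0 ≤ y → y ^ β ≤ K + ε * y := by
  have hδ : 0 < ε ^ (1 / (β - 1)) := by positivity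
  set N : ℝ := ε ^ (1 / (β - 1)) with hN
  refine ⟨N ^ β, fun y hy => ?_⟩
  have h1 : N ^ (β - 1) = ε := by
    rw [hN, ← Real.rpow_mul hε.le, one_div, inv_mul_cancel₀ (by linarith), Real.rpow_one]
  have h2 : (y / N) ^ β ≤ 1 + y / N := by
    have h0 : 0 ≤ y / N := by positivity
    rcases le_total (y / N) 1 with h | h
    · linarith [Real.rpow_le_one h0 h hβ0.le]
    · have := Real.rpow_le_rpow_of_exponent_le h hβ1.le
      rw [Real.rpow_one] at this
      linarith
  calc y ^ β = N ^ β * (y / N) ^ β := by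
        rw [← Real.mul_rpow hδ.le (by positivity), mul_div_cancel₀ _ hδ.ne']
    _ ≤ N ^ β * (1 + y / N) := by gcongr
    _ = N ^ β + N ^ (β - 1) * y := by rw [Real.rpow_sub_one hδ.ne']; ring
    _ = _ := by rw [h1]

/-- The ray from `a` in the direction `e`. -/
noncomputable def ray (a : ℝ) (e : ℂ) (ρ : ℝ) : ℂ := a + ρ * e

lemma ray_re (a : ℝ) (e : ℂ) (ρ : ℝ) : (ray a e ρ).re = a + ρ * e.re := by simp [ray]

lemma ray_im (a : ℝ) (e : ℂ) (ρ : ℝ) : (ray a e ρ).im = ρ * e.im := by simp [ray]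

lemma continuous_ray (a : ℝ) (e : ℂ) : Continuous (ray a e) := by unfold ray; fun_prop

lemma hasDerivAt_ray (a : ℝ) (e : ℂ) (ρ : ℝ) : HasDerivAt (ray a e) e ρ := by
  unfold ray
  have := ((Complex.ofRealCLM.hasDerivAt (x := ρ)).mul_const e).const_add (a : ℂ)
  simpa using! this

lemma norm_ray_le {a : ℝ} (ha : 0 ≤ a) {e : ℂ} (he : ‖e‖ ≤ 1) {ρ : ℝ} (hρ : 0 ≤ ρ) :
    ‖ray a e ρ‖ ≤ a + ρ := by
  calc ‖ray a e ρ‖ ≤ ‖(a : ℂ)‖ + ‖(ρ : ℂ) * e‖ := norm_add_le _ _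
    _ ≤ a + ρ := by
      rw [norm_mul, Complex.norm_real, Complex.norm_real, Real.norm_of_nonneg ha,
        Real.norm_of_nonneg hρ]
      nlinarith

lemma le_norm_ray (a : ℝ) {e : ℂ} (he : ‖e‖ = 1) (ρ : ℝ) : a * e.im ≤ ‖ray a e ρ‖ := by
  calc a * e.im = -((ray a e ρ) * (starRingEnd ℂ) e).im := by
        simp [Complex.mul_im, ray_re, ray_im]; ring
    _ ≤ ‖(ray a e ρ) * (starRingEnd ℂ) e‖ := (neg_le_abs _).trans (Complex.abs_im_le_norm _)
    _ = ‖ray a e ρ‖ := by rw [norm_mul, RCLike.norm_conj, he, mul_one]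

lemma ray_mem_slitPlane {a : ℝ} (ha : 0 < a) {e : ℂ} (he : 0 < e.im) {ρ : ℝ} (hρ : 0 ≤ ρ) :
    ray a e ρ ∈ Complex.slitPlane := by
  rcases hρ.eq_or_lt with rfl | h
  · left; simpa [ray] using ha
  · right; rw [ray_im]; positivity

lemma norm_exp_ray (a : ℝ) (e : ℂ) (ρ : ℝ) :
    ‖Complex.exp (ray a e ρ)‖ = Real.exp a * Real.exp (e.re * ρ) := by
  rw [Complex.norm_exp, ray_re, ← Real.exp_add, mul_comm ρ]

/-- Along the ray, `ζ ^ p` grows more slowly than any exponential. -/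
lemma exists_norm_ray_rpow_le {a : ℝ} (ha : 0 < a) {e : ℂ} (he : ‖e‖ = 1) (hi : 0 < e.im) (p : ℝ)
    {ε : ℝ} (hε : 0 < ε) :
    ∃ K : ℝ, 0 < K ∧ ∀ ρ : ℝ, 0 ≤ ρ → ‖ray a e ρ‖ ^ p ≤ K * Real.exp (ε * ρ) := by
  have hm : 0 < a * e.im := by positivity
  rcases le_total 0 p with hp | hp
  · obtain ⟨K, hK, h⟩ := exists_rpow_le_mul_exp p hp hε
    refine ⟨K * Real.exp (ε * a), by positivity, fun ρ hρ => ?_⟩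
    calc ‖ray a e ρ‖ ^ p ≤ (a + ρ) ^ p := by gcongr; exact norm_ray_le ha.le he.le hρ
      _ ≤ K * Real.exp (ε * (a + ρ)) := h _ (by positivity)
      _ = _ := by rw [mul_add, Real.exp_add]; ring
  · refine ⟨(a * e.im) ^ p, by positivity, fun ρ hρ => ?_⟩
    calc ‖ray a e ρ‖ ^ p ≤ (a * e.im) ^ p :=
          Real.rpow_le_rpow_of_nonpos hm (le_norm_ray a he ρ) hp
      _ ≤ _ := le_mul_of_one_le_right (by positivity) (Real.one_le_exp (by positivity))

lemma continuousOn_ray_cpow {a : ℝ} (ha : 0 < a) {e : ℂ} (hi : 0 < e.im) (p : ℂ) :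
    ContinuousOn (fun ρ => ray a e ρ ^ p) (Ici 0) := fun _ hρ =>
  (ContinuousAt.cpow (continuous_ray a e).continuousAt continuousAt_const
    (ray_mem_slitPlane ha hi hρ)).continuousWithinAt

lemma continuousOn_exp_mul_ray_cpow {a : ℝ} (ha : 0 < a) {e : ℂ} (hi : 0 < e.im) (p : ℂ) :
    ContinuousOn (fun ρ => Complex.exp (ray a e ρ) * ray a e ρ ^ p) (Ici 0) :=
  (Complex.continuous_exp.comp (continuous_ray a e)).continuousOn.mul
    (continuousOn_ray_cpow ha hi p)

/-- The Hankel integrand decays exponentially along the ray. -/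
lemma exists_norm_exp_mul_ray_cpow_le {a : ℝ} (ha : 0 < a) {e : ℂ} (he : ‖e‖ = 1) (hi : 0 < e.im)
    (hr : e.re < 0) (p : ℝ) :
    ∃ K : ℝ, 0 < K ∧ ∀ ρ : ℝ, 0 ≤ ρ →
      ‖Complex.exp (ray a e ρ)‖ * ‖ray a e ρ‖ ^ p ≤ K * Real.exp (e.re / 2 * ρ) := by
  obtain ⟨K, hK, h⟩ := exists_norm_ray_rpow_le ha he hi p (ε := -e.re / 2) (by linarith)
  refine ⟨Real.exp a * K, by positivity, fun ρ hρ => ?_⟩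
  rw [norm_exp_ray]
  calc Real.exp a * Real.exp (e.re * ρ) * ‖ray a e ρ‖ ^ p
      ≤ Real.exp a * Real.exp (e.re * ρ) * (K * Real.exp (-e.re / 2 * ρ)) := by
        gcongr; exact h ρ hρ
    _ = Real.exp a * K * (Real.exp (e.re * ρ) * Real.exp (-e.re / 2 * ρ)) := by ring
    _ = _ := by rw [← Real.exp_add]; congr 2; ring

lemma integrableOn_exp_mul_ray_cpow {a : ℝ} (ha : 0 < a) {e : ℂ} (he : ‖e‖ = 1) (hi : 0 < e.im)
    (hr : e.re < 0) (p : ℝ) :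
    IntegrableOn (fun ρ => Complex.exp (ray a e ρ) * ray a e ρ ^ (p : ℂ)) (Ioi 0) := by
  obtain ⟨K, -, h⟩ := exists_norm_exp_mul_ray_cpow_le ha he hi hr p
  refine Integrable.mono' ((integrableOn_exp_mul_Ioi (a := e.re / 2) (by linarith) 0).const_mul K)
    (((continuousOn_exp_mul_ray_cpow ha hi p).mono Ioi_subset_Ici_self).aestronglyMeasurable
      measurableSet_Ioi) ?_
  filter_upwards [ae_restrict_mem measurableSet_Ioi] with ρ hρ
  rw [norm_mul, Complex.norm_cpow_real]
  exact h ρ (le_of_lt hρ)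

lemma tendsto_exp_mul_ray_cpow {a : ℝ} (ha : 0 < a) {e : ℂ} (he : ‖e‖ = 1) (hi : 0 < e.im)
    (hr : e.re < 0) (p : ℝ) :
    Tendsto (fun ρ => Complex.exp (ray a e ρ) * ray a e ρ ^ (p : ℂ)) atTop (nhds 0) := by
  obtain ⟨K, -, h⟩ := exists_norm_exp_mul_ray_cpow_le ha he hi hr p
  refine squeeze_zero_norm' (a := fun ρ => K * Real.exp (e.re / 2 * ρ)) ?_ ?_
  · filter_upwards [eventually_ge_atTop 0] with ρ hρ
    rw [norm_mul, Complex.norm_cpow_real]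
    exact h ρ hρ
  · rw [← mul_zero K]
    exact (Real.tendsto_exp_atBot.comp
      (tendsto_id.const_mul_atTop_of_neg (by linarith))).const_mul K

lemma hasDerivAt_exp_mul_cpow {z : ℂ} (hz : z ∈ Complex.slitPlane) (p : ℂ) :
    HasDerivAt (fun z => Complex.exp z * z ^ p)
      (Complex.exp z * z ^ p + p * (Complex.exp z * z ^ (p - 1))) z := by
  have := (Complex.hasDerivAt_exp z).mul ((hasDerivAt_id z).cpow_const (c := p) hz)
  convert! this using 1
  simp; ring

/-- Half of the Hankel contour integral, along the ray from `a` in the direction `e`. -/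
noncomputable def hankelRay (a : ℝ) (e : ℂ) (p : ℝ) : ℂ :=
  (∫ ρ in Ioi (0 : ℝ), Complex.exp (ray a e ρ) * ray a e ρ ^ (p : ℂ)) * e

lemma hankelRay_add {a : ℝ} (ha : 0 < a) {e : ℂ} (he : ‖e‖ = 1) (hi : 0 < e.im)
    (hr : e.re < 0) (p : ℝ) :
    hankelRay a e p + p * hankelRay a e (p - 1) = -((Real.exp a * a ^ p : ℝ) : ℂ) := by
  have I1 := integrableOn_exp_mul_ray_cpow ha he hi hr p
  have I2 := integrableOn_exp_mul_ray_cpow ha he hi hr (p - 1)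
  have hd : ∀ ρ ∈ Ici (0 : ℝ), HasDerivAt
      (fun ρ => Complex.exp (ray a e ρ) * ray a e ρ ^ (p : ℂ))
      ((Complex.exp (ray a e ρ) * ray a e ρ ^ (p : ℂ) +
        p * (Complex.exp (ray a e ρ) * ray a e ρ ^ ((p - 1 : ℝ) : ℂ))) * e) ρ := fun ρ hρ => by
    push_cast
    exact (hasDerivAt_exp_mul_cpow (ray_mem_slitPlane ha hi hρ) p).comp ρ (hasDerivAt_ray a e ρ)
  have key := integral_Ioi_of_hasDerivAt_of_tendsto' hd ((I1.add (I2.const_mul (p : ℂ))).mul_const e)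
    (tendsto_exp_mul_ray_cpow ha he hi hr p)
  rw [integral_mul_const, integral_add I1 (I2.const_mul _), integral_const_mul] at key
  unfold hankelRay
  rw [← mul_assoc, ← add_mul, key]
  simp [ray, Complex.ofReal_cpow ha.le]

/-- The ray joining the upper edge of the negative axis (`τ = 0`) to the ray from `a` in the
direction `e` (`τ = 1`). -/
noncomputable def tiltedRay (a : ℝ) (e : ℂ) (τ ρ : ℝ) : ℂ := ray (τ * a) (-1 + τ * (e + 1)) ρ

lemma tiltedRay_im (a : ℝ) (e : ℂ) (τ ρ : ℝ) : (tiltedRay a e τ ρ).im = ρ * (τ * e.im) := by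
  simp [tiltedRay, ray_im]

lemma tiltedRay_mem_slitPlane {a : ℝ} (ha : 0 < a) {e : ℂ} (hi : 0 < e.im) {τ ρ : ℝ} (hτ : 0 < τ)
    (hρ : 0 ≤ ρ) : tiltedRay a e τ ρ ∈ Complex.slitPlane :=
  ray_mem_slitPlane (by positivity) (by simp; positivity) hρ

lemma hasDerivAt_tiltedRay_left (a : ℝ) (e : ℂ) (τ ρ : ℝ) :
    HasDerivAt (fun τ => tiltedRay a e τ ρ) (a + ρ * (e + 1)) τ := by
  unfold tiltedRay ray
  have h := Complex.ofRealCLM.hasDerivAt (x := τ)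
  have := (h.mul_const (a : ℂ)).add (((h.mul_const (e + 1)).const_add (-1)).const_mul (ρ : ℂ))
  simpa using! this

lemma hasDerivAt_tiltedRay_right (a : ℝ) (e : ℂ) (τ ρ : ℝ) :
    HasDerivAt (tiltedRay a e τ) (-1 + τ * (e + 1)) ρ := hasDerivAt_ray _ _ _

lemma norm_exp_tiltedRay_le {a : ℝ} (ha : 0 < a) {e : ℂ} (he : ‖e‖ = 1) {τ ρ : ℝ}
    (hτ : τ ∈ Icc (0 : ℝ) 1) (hρ : 0 ≤ ρ) :
    ‖Complex.exp (tiltedRay a e τ ρ)‖ ≤ Real.exp a * Real.exp (e.re * ρ) := by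
  have h1 : -1 ≤ e.re := by
    have := (abs_le.mp (Complex.abs_re_le_norm e)).1
    rwa [he] at this
  rw [Complex.norm_exp, ← Real.exp_add]
  apply Real.exp_le_exp.mpr
  have : (tiltedRay a e τ ρ).re = τ * a + ρ * (-1 + τ * (e.re + 1)) := by
    simp [tiltedRay, ray_re]
  rw [this]
  have h2 : τ * a ≤ a := by nlinarith [hτ.2]
  have h3 : τ * (e.re + 1) ≤ e.re + 1 := by nlinarith [hτ.2]
  nlinarith

lemma norm_tilt_le {e : ℂ} (he : ‖e‖ = 1) {τ : ℝ} (hτ : τ ∈ Icc (0 : ℝ) 1) :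
    ‖-1 + (τ : ℂ) * (e + 1)‖ ≤ 1 := by
  have h : -1 + (τ : ℂ) * (e + 1) = ((τ - 1 : ℝ) : ℂ) + (τ : ℂ) * e := by push_cast; ring
  rw [h]
  refine (norm_add_le _ _).trans ?_
  rw [norm_mul, he, Complex.norm_real, Complex.norm_real, Real.norm_of_nonneg hτ.1,
    Real.norm_of_nonpos (by linarith [hτ.2])]
  linarith

lemma norm_tiltedRay_le {a : ℝ} (ha : 0 < a) {e : ℂ} (he : ‖e‖ = 1) {τ ρ : ℝ}
    (hτ : τ ∈ Icc (0 : ℝ) 1) (hρ : 0 ≤ ρ) : ‖tiltedRay a e τ ρ‖ ≤ a + ρ := by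
  refine (norm_ray_le (mul_nonneg hτ.1 ha.le) (norm_tilt_le he hτ) hρ).trans ?_
  nlinarith [hτ.2]

lemma norm_tiltedRay_deriv_le {a : ℝ} (ha : 0 < a) {e : ℂ} (he : ‖e‖ = 1) {ρ : ℝ} (hρ : 0 ≤ ρ) :
    ‖(a : ℂ) + ρ * (e + 1)‖ ≤ 2 * (a + ρ) := by
  refine (norm_add_le _ _).trans ?_
  have h : ‖e + 1‖ ≤ 2 := (norm_add_le _ _).trans (by rw [he, norm_one]; norm_num)
  rw [norm_mul, Complex.norm_real, Complex.norm_real, Real.norm_of_nonneg hρ,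
    Real.norm_of_nonneg ha.le]
  nlinarith

/-- The common mixed derivative in the homotopy argument. -/
noncomputable def tiltedDeriv (a : ℝ) (e : ℂ) (p : ℝ) (τ ρ : ℝ) : ℂ :=
  (Complex.exp (tiltedRay a e τ ρ) * tiltedRay a e τ ρ ^ (p : ℂ) +
      p * (Complex.exp (tiltedRay a e τ ρ) * tiltedRay a e τ ρ ^ ((p - 1 : ℝ) : ℂ))) *
    (-1 + τ * (e + 1)) * (a + ρ * (e + 1)) +
  Complex.exp (tiltedRay a e τ ρ) * tiltedRay a e τ ρ ^ (p : ℂ) * (e + 1)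

lemma exists_norm_tilted_le {a : ℝ} (ha : 0 < a) {e : ℂ} (he : ‖e‖ = 1) (hr : e.re < 0) {p : ℝ}
    (hp : 1 ≤ p) :
    ∃ K : ℝ, 0 < K ∧ ∀ τ ∈ Icc (0 : ℝ) 1, ∀ ρ : ℝ, 0 ≤ ρ →
      ‖tiltedDeriv a e p τ ρ‖ ≤ K * Real.exp (e.re / 2 * ρ) ∧
      ‖Complex.exp (tiltedRay a e τ ρ) * tiltedRay a e τ ρ ^ (p : ℂ) * (a + ρ * (e + 1))‖
        ≤ K * Real.exp (e.re / 2 * ρ) := by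
  obtain ⟨K₁, hK₁, h₁⟩ := exists_rpow_le_mul_exp (p + 1) (by linarith) (ε := -e.re / 2)
    (by linarith)
  obtain ⟨K₂, hK₂, h₂⟩ := exists_rpow_le_mul_exp p (by linarith) (ε := -e.re / 2) (by linarith)
  refine ⟨Real.exp a * ((2 * K₁ + (2 * p + 2) * K₂) * Real.exp (-e.re / 2 * a)), by positivity,
    fun τ hτ ρ hρ => ?_⟩
  set σ := tiltedRay a e τ ρ with hσ
  have hy : 0 < a + ρ := by positivity
  have hE := norm_exp_tiltedRay_le ha he hτ hρ
  have hn := norm_tiltedRay_le ha he hτ hρ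
  have ht := norm_tilt_le he hτ
  have hd := norm_tiltedRay_deriv_le ha he hρ
  have h2 : ‖e + 1‖ ≤ 2 := (norm_add_le _ _).trans (by rw [he, norm_one]; norm_num)
  rw [← hσ] at hE hn
  have hp1 : ‖σ ^ (p : ℂ)‖ ≤ (a + ρ) ^ p := by
    rw [Complex.norm_cpow_real]; gcongr
  have hp2 : ‖σ ^ ((p - 1 : ℝ) : ℂ)‖ ≤ (a + ρ) ^ (p - 1) := by
    rw [Complex.norm_cpow_real]
    exact Real.rpow_le_rpow (norm_nonneg _) hn (by linarith)
  have e1 : (a + ρ) ^ (p + 1) = (a + ρ) ^ p * (a + ρ) := Real.rpow_add_one hy.ne' p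
  have e2 : (a + ρ) ^ p = (a + ρ) ^ (p - 1) * (a + ρ) := by
    rw [← Real.rpow_add_one hy.ne']; simp
  have hfin : Real.exp a * Real.exp (e.re * ρ) * (2 * (a + ρ) ^ (p + 1) +
      (2 * p + 2) * (a + ρ) ^ p) ≤
      Real.exp a * ((2 * K₁ + (2 * p + 2) * K₂) * Real.exp (-e.re / 2 * a)) *
        Real.exp (e.re / 2 * ρ) := by
    calc _ ≤ Real.exp a * Real.exp (e.re * ρ) * (2 * (K₁ * Real.exp (-e.re / 2 * (a + ρ))) +
          (2 * p + 2) * (K₂ * Real.exp (-e.re / 2 * (a + ρ)))) := by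
          gcongr
          · exact h₁ _ hy.le
          · exact h₂ _ hy.le
      _ = Real.exp a * (2 * K₁ + (2 * p + 2) * K₂) *
          (Real.exp (e.re * ρ) * Real.exp (-e.re / 2 * (a + ρ))) := by ring
      _ = Real.exp a * (2 * K₁ + (2 * p + 2) * K₂) *
          (Real.exp (-e.re / 2 * a) * Real.exp (e.re / 2 * ρ)) := by
          rw [← Real.exp_add, ← Real.exp_add]; congr 2; ring
      _ = _ := by ring
  constructor
  · refine le_trans ?_ hfin
    have n1 : ‖(p : ℂ)‖ = p := by rw [Complex.norm_real, Real.norm_of_nonneg (by linarith)]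
    unfold tiltedDeriv
    rw [← hσ]
    calc _ ≤ (‖Complex.exp σ‖ * ‖σ ^ (p : ℂ)‖ + ‖(p : ℂ)‖ *
          (‖Complex.exp σ‖ * ‖σ ^ ((p - 1 : ℝ) : ℂ)‖)) * ‖-1 + (τ : ℂ) * (e + 1)‖ *
          ‖(a : ℂ) + ρ * (e + 1)‖ + ‖Complex.exp σ‖ * ‖σ ^ (p : ℂ)‖ * ‖e + 1‖ := by
          refine (norm_add_le _ _).trans ?_
          rw [norm_mul, norm_mul, norm_mul (_ * _) (e + 1), norm_mul (Complex.exp σ)]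
          gcongr
          refine (norm_add_le _ _).trans ?_
          simp only [norm_mul, le_refl]
      _ ≤ ((Real.exp a * Real.exp (e.re * ρ)) * (a + ρ) ^ p + p *
          ((Real.exp a * Real.exp (e.re * ρ)) * (a + ρ) ^ (p - 1))) * 1 *
          (2 * (a + ρ)) + (Real.exp a * Real.exp (e.re * ρ)) * (a + ρ) ^ p * 2 := by
          rw [n1]; gcongr
      _ = _ := by rw [e1]; linear_combination (-(2 * p * (Real.exp a * Real.exp (e.re * ρ)))) * e2
  · refine le_trans ?_ hfin
    rw [norm_mul, norm_mul]
    calc _ ≤ (Real.exp a * Real.exp (e.re * ρ)) * (a + ρ) ^ p * (2 * (a + ρ)) := by gcongr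
      _ = Real.exp a * Real.exp (e.re * ρ) * (2 * (a + ρ) ^ (p + 1)) := by rw [e1]; ring
      _ ≤ _ := by gcongr; linarith [show 0 ≤ (2 * p + 2) * (a + ρ) ^ p by positivity]

lemma continuousOn_tiltedDeriv {a : ℝ} (ha : 0 < a) {e : ℂ} (hi : 0 < e.im) (p : ℝ) :
    ContinuousOn (Function.uncurry (tiltedDeriv a e p)) (Ioi 0 ×ˢ Ici 0) := by
  have hc : Continuous fun q : ℝ × ℝ => tiltedRay a e q.1 q.2 := by
    unfold tiltedRay ray; fun_prop
  have hpow : ∀ c : ℂ, ContinuousOn (fun q : ℝ × ℝ => tiltedRay a e q.1 q.2 ^ c)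
      (Ioi 0 ×ˢ Ici 0) := fun c q hq =>
    (ContinuousAt.cpow hc.continuousAt continuousAt_const
      (tiltedRay_mem_slitPlane ha hi hq.1 hq.2)).continuousWithinAt
  have hexp : ContinuousOn (fun q : ℝ × ℝ => Complex.exp (tiltedRay a e q.1 q.2))
      (Ioi 0 ×ˢ Ici 0) := (Complex.continuous_exp.comp hc).continuousOn
  have h1 := hexp.mul (hpow p)
  have h2 := hexp.mul (hpow ((p - 1 : ℝ) : ℂ))
  exact (((h1.add (h2.const_smul (p : ℂ))).mul (by fun_prop)).mul (by fun_prop)).add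
    (h1.mul continuousOn_const)

lemma integral_tiltedDeriv_right {a : ℝ} (ha : 0 < a) {e : ℂ} (he : ‖e‖ = 1) (hi : 0 < e.im)
    (hr : e.re < 0) {p : ℝ} (hp : 1 ≤ p) {τ : ℝ} (hτ : τ ∈ Ioc (0 : ℝ) 1) :
    ∫ ρ in Ioi (0 : ℝ), tiltedDeriv a e p τ ρ =
      ((-(Real.exp (τ * a) * (τ * a) ^ p * a) : ℝ) : ℂ) := by
  obtain ⟨K, -, hK⟩ := exists_norm_tilted_le ha he hr hp
  have hτ' : τ ∈ Icc (0 : ℝ) 1 := ⟨hτ.1.le, hτ.2⟩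
  have hd : ∀ ρ ∈ Ici (0 : ℝ), HasDerivAt (fun ρ : ℝ => Complex.exp (tiltedRay a e τ ρ) *
      tiltedRay a e τ ρ ^ (p : ℂ) * (a + ρ * (e + 1))) (tiltedDeriv a e p τ ρ) ρ := fun ρ hρ => by
    have h1 := (hasDerivAt_exp_mul_cpow (tiltedRay_mem_slitPlane ha hi hτ.1 hρ) p).comp ρ
      (hasDerivAt_tiltedRay_right a e τ ρ)
    have h2 := ((Complex.ofRealCLM.hasDerivAt (x := ρ)).mul_const (e + 1)).const_add (a : ℂ)
    have h3 := h1.mul h2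
    unfold tiltedDeriv
    simpa using! h3
  have hInt : IntegrableOn (tiltedDeriv a e p τ) (Ioi 0) := by
    refine Integrable.mono' ((integrableOn_exp_mul_Ioi (a := e.re / 2) (by linarith) 0).const_mul K)
      (ContinuousOn.aestronglyMeasurable ?_ measurableSet_Ioi) ?_
    · exact (continuousOn_tiltedDeriv ha hi p).comp (f := fun ρ => (τ, ρ)) (by fun_prop)
        fun ρ hρ => ⟨hτ.1, mem_Ici.mpr (le_of_lt (mem_Ioi.mp hρ))⟩
    · filter_upwards [ae_restrict_mem measurableSet_Ioi] with ρ hρ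
      exact (hK τ hτ' ρ (le_of_lt hρ)).1
  have hlim : Tendsto (fun ρ : ℝ => Complex.exp (tiltedRay a e τ ρ) *
      tiltedRay a e τ ρ ^ (p : ℂ) * (a + ρ * (e + 1))) atTop (nhds 0) := by
    refine squeeze_zero_norm' (a := fun ρ => K * Real.exp (e.re / 2 * ρ)) ?_ ?_
    · filter_upwards [eventually_ge_atTop 0] with ρ hρ
      exact (hK τ hτ' ρ hρ).2
    · rw [← mul_zero K]
      exact (Real.tendsto_exp_atBot.comp
        (tendsto_id.const_mul_atTop_of_neg (by linarith))).const_mul K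
  rw [integral_Ioi_of_hasDerivAt_of_tendsto' hd hInt hlim]
  simp [tiltedRay, ray, Complex.ofReal_cpow (mul_pos hτ.1 ha).le]

lemma integral_tiltedDeriv_left {a : ℝ} (ha : 0 < a) {e : ℂ} (he : ‖e‖ = 1) (hi : 0 < e.im)
    (hr : e.re < 0) {p : ℝ} (hp : 1 ≤ p) {ρ : ℝ} (hρ : 0 < ρ) :
    ∫ τ in (0 : ℝ)..1, tiltedDeriv a e p τ ρ =
      Complex.exp (ray a e ρ) * ray a e ρ ^ (p : ℂ) * e +
        Complex.exp (-ρ : ℂ) * (-ρ : ℂ) ^ (p : ℂ) := by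
  obtain ⟨K, -, hK⟩ := exists_norm_tilted_le ha he hr hp
  have hd : ∀ τ ∈ Ioi (0 : ℝ), HasDerivAt (fun τ : ℝ => Complex.exp (tiltedRay a e τ ρ) *
      tiltedRay a e τ ρ ^ (p : ℂ) * (-1 + τ * (e + 1))) (tiltedDeriv a e p τ ρ) τ := fun τ hτ => by
    have h1 := (hasDerivAt_exp_mul_cpow (tiltedRay_mem_slitPlane ha hi hτ hρ.le) p).comp τ
      (hasDerivAt_tiltedRay_left a e τ ρ)
    have h2 := ((Complex.ofRealCLM.hasDerivAt (x := τ)).mul_const (e + 1)).const_add (-1 : ℂ)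
    have h3 := h1.mul h2
    unfold tiltedDeriv
    convert! h3 using 1
    simp
    ring
  have hInt : IntervalIntegrable (fun τ => tiltedDeriv a e p τ ρ) volume 0 1 := by
    rw [intervalIntegrable_iff_integrableOn_Ioc_of_le zero_le_one]
    refine Integrable.mono' (integrable_const (K * Real.exp (e.re / 2 * ρ)))
      (ContinuousOn.aestronglyMeasurable ?_ measurableSet_Ioc) ?_
    · exact (continuousOn_tiltedDeriv ha hi p).comp (f := fun τ => (τ, ρ)) (by fun_prop)
        fun τ hτ => ⟨hτ.1, hρ.le⟩
    · filter_upwards [ae_restrict_mem measurableSet_Ioc] with τ hτ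
      exact (hK τ ⟨hτ.1.le, hτ.2⟩ ρ hρ.le).1
  have hcont : ContinuousOn (fun τ : ℝ => Complex.exp (tiltedRay a e τ ρ) *
      tiltedRay a e τ ρ ^ (p : ℂ) * (-1 + τ * (e + 1))) (Icc 0 1) := by
    intro τ hτ
    rcases hτ.1.eq_or_lt with h0 | h0
    · subst h0
      have hz : tiltedRay a e 0 ρ = -ρ := by simp [tiltedRay, ray]
      have hc : Continuous fun τ => tiltedRay a e τ ρ := by unfold tiltedRay ray; fun_prop
      have hlog : ContinuousWithinAt (fun τ => Complex.log (tiltedRay a e τ ρ)) (Icc 0 1) 0 := by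
        refine ContinuousWithinAt.comp (t := {z : ℂ | 0 ≤ z.im}) (g := Complex.log) ?_
          hc.continuousWithinAt fun τ hτ => ?_
        · refine Complex.continuousWithinAt_log_of_re_neg_of_im_zero ?_ ?_ <;> simp [hz, hρ]
        · have := hτ.1
          rw [mem_ofPred_eq, tiltedRay_im]; positivity
      have hne : ∀ τ ∈ Icc (0 : ℝ) 1, tiltedRay a e τ ρ ≠ 0 := by
        intro τ hτ
        rcases hτ.1.eq_or_lt with h | h
        · rw [← h, hz]; simpa using hρ.ne'
        · exact Complex.slitPlane_ne_zero (tiltedRay_mem_slitPlane ha hi h hρ.le)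
      have hpow : ContinuousWithinAt (fun τ => tiltedRay a e τ ρ ^ (p : ℂ)) (Icc 0 1) 0 := by
        refine ContinuousWithinAt.congr (f := fun τ =>
          Complex.exp (Complex.log (tiltedRay a e τ ρ) * p)) ?_ ?_ ?_
        · exact (hlog.mul continuousWithinAt_const).cexp
        · intro τ hτ
          exact Complex.cpow_def_of_ne_zero (hne τ hτ) _
        · exact Complex.cpow_def_of_ne_zero (hne 0 hτ) _
      exact ((Complex.continuous_exp.comp hc).continuousWithinAt.mul hpow).mul
        (Continuous.continuousWithinAt (by fun_prop))
    · exact (hd τ h0).continuousAt.continuousWithinAt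
  rw [intervalIntegral.integral_eq_sub_of_hasDerivAt_of_le zero_le_one hcont
    (fun τ hτ => hd τ hτ.1) hInt]
  simp [tiltedRay]
  simp [ray]

lemma im_hankelRay_of_one_le {a : ℝ} (ha : 0 < a) {e : ℂ} (he : ‖e‖ = 1) (hi : 0 < e.im)
    (hr : e.re < 0) {p : ℝ} (hp : 1 ≤ p) :
    (hankelRay a e p).im = π / Real.Gamma (-p) := by
  obtain ⟨K, hK0, hK⟩ := exists_norm_tilted_le ha he hr hp
  have hprod : Integrable (Function.uncurry (tiltedDeriv a e p))
      ((volume.restrict (Set.uIoc 0 1)).prod (volume.restrict (Ioi 0))) := by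
    rw [Set.uIoc_of_le zero_le_one]
    refine Integrable.mono' (((integrableOn_exp_mul_Ioi (a := e.re / 2) (by linarith) 0).const_mul
      K).comp_snd (volume.restrict (Ioc (0 : ℝ) 1))) ?_ ?_
    · rw [Measure.prod_restrict]
      refine ContinuousOn.aestronglyMeasurable ((continuousOn_tiltedDeriv ha hi p).mono ?_)
        (measurableSet_Ioc.prod measurableSet_Ioi)
      exact prod_mono Ioc_subset_Ioi_self Ioi_subset_Ici_self
    · rw [Measure.prod_restrict]
      filter_upwards [ae_restrict_mem (measurableSet_Ioc.prod measurableSet_Ioi)] with q hq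
      exact (hK q.1 ⟨hq.1.1.le, hq.1.2⟩ q.2 (le_of_lt hq.2)).1
  have hswap := intervalIntegral_integral_swap hprod
  have hL : ∫ τ in (0 : ℝ)..1, ∫ ρ in Ioi (0 : ℝ), tiltedDeriv a e p τ ρ =
      ((∫ τ in (0 : ℝ)..1, -(Real.exp (τ * a) * (τ * a) ^ p * a) : ℝ) : ℂ) := by
    rw [← intervalIntegral.integral_ofReal]
    refine intervalIntegral.integral_congr_ae (ae_of_all _ fun τ hτ => ?_)
    rw [Set.uIoc_of_le zero_le_one] at hτ
    exact integral_tiltedDeriv_right ha he hi hr hp hτ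
  have hpow : ∀ ρ ∈ Ioi (0 : ℝ), Complex.exp (-ρ : ℂ) * (-ρ : ℂ) ^ (p : ℂ) =
      ((Real.exp (-ρ) * ρ ^ ((p + 1) - 1) : ℝ) : ℂ) * Complex.exp (π * Complex.I * p) := by
    intro ρ hρ
    have := Complex.ofReal_cpow_of_nonpos (x := -ρ) (by simpa using le_of_lt hρ) p
    push_cast at this
    rw [this, neg_neg, add_sub_cancel_right]
    push_cast
    rw [Complex.ofReal_cpow (le_of_lt hρ)]
    ring
  have hG : IntegrableOn (fun ρ : ℝ => Real.exp (-ρ) * ρ ^ ((p + 1) - 1)) (Ioi 0) :=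
    Real.GammaIntegral_convergent (by linarith)
  have hG' : IntegrableOn (fun ρ : ℝ => ((Real.exp (-ρ) * ρ ^ ((p + 1) - 1) : ℝ) : ℂ)) (Ioi 0) :=
    hG.ofReal
  have hR : ∫ ρ in Ioi (0 : ℝ), (∫ τ in (0 : ℝ)..1, tiltedDeriv a e p τ ρ) =
      hankelRay a e p + Real.Gamma (p + 1) * Complex.exp (π * Complex.I * p) := by
    rw [setIntegral_congr_fun measurableSet_Ioi fun ρ hρ =>
      (integral_tiltedDeriv_left ha he hi hr hp hρ).trans (by rw [hpow ρ hρ])]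
    rw [integral_add ((integrableOn_exp_mul_ray_cpow ha he hi hr p).mul_const e)
      (hG'.mul_const _), integral_mul_const, integral_mul_const, integral_complex_ofReal,
      Real.Gamma_eq_integral (by linarith)]
    rfl
  rw [hL, hR] at hswap
  have him := congrArg Complex.im hswap
  have hex : Complex.exp (π * Complex.I * p) = Complex.exp (((π * p : ℝ) : ℂ) * Complex.I) := by
    congr 1; push_cast; ring
  rw [Complex.ofReal_im, Complex.add_im, Complex.im_ofReal_mul, hex,
    Complex.exp_ofReal_mul_I_im] at him
  have hrefl := Real.Gamma_mul_Gamma_one_sub (-p)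
  rw [sub_neg_eq_add, mul_neg, Real.sin_neg, add_comm 1 p] at hrefl
  have hGpos : 0 < Real.Gamma (p + 1) := Real.Gamma_pos_of_pos (by linarith)
  have hval : (hankelRay a e p).im = -(Real.Gamma (p + 1) * Real.sin (π * p)) := by linarith
  rw [hval]
  by_cases hs : Real.sin (π * p) = 0
  · rw [hs, neg_zero, div_zero] at hrefl
    have : Real.Gamma (-p) = 0 := by
      rcases mul_eq_zero.mp hrefl with h | h
      · exact h
      · exact absurd h hGpos.ne'
    rw [this, hs]; simp
  · have : Real.Gamma (-p) ≠ 0 := by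
      intro h0
      rw [h0, zero_mul] at hrefl
      exact absurd hrefl.symm (div_ne_zero Real.pi_pos.ne' (neg_ne_zero.mpr hs))
    rw [eq_div_iff (neg_ne_zero.mpr hs)] at hrefl
    rw [eq_div_iff this]
    linarith

lemma continuousAt_hankelRay {a : ℝ} (ha : 0 < a) {e : ℂ} (he : ‖e‖ = 1) (hi : 0 < e.im)
    (hr : e.re < 0) (p₀ : ℝ) : ContinuousAt (hankelRay a e) p₀ := by
  have hInt : ∀ p : ℝ, IntegrableOn
      (fun ρ => ‖Complex.exp (ray a e ρ)‖ * ‖ray a e ρ‖ ^ p) (Ioi 0) := fun p => by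
    simpa only [norm_mul, Complex.norm_cpow_real] using!
      (integrableOn_exp_mul_ray_cpow ha he hi hr p).norm
  unfold hankelRay
  refine ContinuousAt.mul (continuousAt_of_dominated (bound := fun ρ =>
    ‖Complex.exp (ray a e ρ)‖ * ‖ray a e ρ‖ ^ (p₀ - 1) +
      ‖Complex.exp (ray a e ρ)‖ * ‖ray a e ρ‖ ^ (p₀ + 1)) ?_ ?_
    ((hInt (p₀ - 1)).add (hInt (p₀ + 1))) ?_) continuousAt_const
  · exact Eventually.of_forall fun p => (integrableOn_exp_mul_ray_cpow ha he hi hr p).1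
  · filter_upwards [Icc_mem_nhds (show p₀ - 1 < p₀ by linarith) (show p₀ < p₀ + 1 by linarith)]
      with p hp
    filter_upwards [ae_restrict_mem measurableSet_Ioi] with ρ hρ
    rw [norm_mul, Complex.norm_cpow_real, ← mul_add]
    gcongr
    have hpos : 0 < ‖ray a e ρ‖ :=
      norm_pos_iff.mpr (Complex.slitPlane_ne_zero (ray_mem_slitPlane ha hi (le_of_lt hρ)))
    rcases le_total ‖ray a e ρ‖ 1 with h | h
    · exact (Real.rpow_le_rpow_of_exponent_ge hpos h hp.1).trans
        (le_add_of_nonneg_right (by positivity))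
    · exact (Real.rpow_le_rpow_of_exponent_le h hp.2).trans
        (le_add_of_nonneg_left (by positivity))
  · filter_upwards [ae_restrict_mem measurableSet_Ioi] with ρ hρ
    have hne := Complex.slitPlane_ne_zero (ray_mem_slitPlane ha hi (le_of_lt (mem_Ioi.mp hρ)))
    exact continuousAt_const.mul (ContinuousAt.const_cpow
      Complex.continuous_ofReal.continuousAt (Or.inl hne))

lemma im_hankelRay_of_add_one {a : ℝ} (ha : 0 < a) {e : ℂ} (he : ‖e‖ = 1) (hi : 0 < e.im)
    (hr : e.re < 0) {p : ℝ} (hp : p + 1 ≠ 0)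
    (h : (hankelRay a e (p + 1)).im = π / Real.Gamma (-(p + 1))) :
    (hankelRay a e p).im = π / Real.Gamma (-p) := by
  have h1 := congrArg Complex.im (hankelRay_add ha he hi hr (p + 1))
  rw [Complex.add_im, Complex.im_ofReal_mul, add_sub_cancel_right, Complex.neg_im,
    Complex.ofReal_im, h] at h1
  have h2 := Real.Gamma_add_one (s := -(p + 1)) (neg_ne_zero.mpr hp)
  rw [show -(p + 1) + 1 = -p by ring] at h2
  rw [h2]
  have h3 : (hankelRay a e p).im = -(π / Real.Gamma (-(p + 1))) / (p + 1) := by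
    rw [eq_div_iff hp]; linarith
  rw [h3, neg_mul, div_neg, neg_div, div_div, mul_comm]

/-- The Hankel formula for the reciprocal Gamma function. -/
lemma im_hankelRay {a : ℝ} (ha : 0 < a) {e : ℂ} (he : ‖e‖ = 1) (hi : 0 < e.im)
    (hr : e.re < 0) (p : ℝ) : (hankelRay a e p).im = π / Real.Gamma (-p) := by
  have key : ∀ n : ℕ, ∀ p : ℝ, 1 - (n : ℝ) ≤ p →
      (hankelRay a e p).im = π / Real.Gamma (-p) := by
    intro n
    induction n with
    | zero => intro p hp; exact im_hankelRay_of_one_le ha he hi hr (by simpa using hp)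
    | succ n ih =>
      intro p hp
      push_cast at hp
      by_cases h : p + 1 = 0
      · obtain rfl : p = -1 := by linarith
        have hev : (fun p => (hankelRay a e p).im) =ᶠ[nhdsWithin (-1) (Ioi (-1))]
            fun p => π / Real.Gamma (-p) := by
          filter_upwards [self_mem_nhdsWithin] with q hq
          have hq' : -1 < q := hq
          exact im_hankelRay_of_add_one ha he hi hr (by linarith) (ih _ (by linarith))
        have h1 : Tendsto (fun p => (hankelRay a e p).im) (nhdsWithin (-1) (Ioi (-1)))
            (nhds (hankelRay a e (-1)).im) :=
          ((Complex.continuous_im.continuousAt.comp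
            (continuousAt_hankelRay ha he hi hr (-1))).tendsto).mono_left nhdsWithin_le_nhds
        have hG : ContinuousAt (fun p : ℝ => π / Real.Gamma (-p)) (-1) := by
          refine ContinuousAt.div continuousAt_const ?_ (by simp)
          refine ContinuousAt.comp (g := Real.Gamma) ?_ continuous_neg.continuousAt
          refine (Real.differentiableAt_Gamma fun m => ?_).continuousAt
          rw [neg_neg]
          have : (0 : ℝ) ≤ m := Nat.cast_nonneg m
          linarith
        exact tendsto_nhds_unique h1
          ((hG.tendsto.mono_left nhdsWithin_le_nhds).congr' hev.symm)
      · exact im_hankelRay_of_add_one ha he hi hr h (ih _ (by linarith))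
  obtain ⟨n, hn⟩ := exists_nat_ge (1 - p)
  exact key n p (by linarith)

lemma arg_ray_le {a : ℝ} (ha : 0 < a) {e : ℂ} (hi : 0 < e.im) {ρ : ℝ} (hρ : 0 < ρ) :
    (ray a e ρ).arg ≤ e.arg := by
  by_contra! h
  have h1 : 0 ≤ e.arg := Complex.arg_nonneg_iff.mpr hi.le
  have h2 := Complex.arg_lt_pi_iff.mpr (Or.inr (show (ray a e ρ).im ≠ 0 by
    rw [ray_im]; positivity))
  have h3 : 0 < Real.sin ((ray a e ρ).arg - e.arg) :=
    Real.sin_pos_of_pos_of_lt_pi (by linarith) (by linarith)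
  have h4 : ‖ray a e ρ‖ * ‖e‖ * Real.sin ((ray a e ρ).arg - e.arg) = -(a * e.im) := by
    calc _ = (‖ray a e ρ‖ * Real.sin (ray a e ρ).arg) * (‖e‖ * Real.cos e.arg) -
          (‖ray a e ρ‖ * Real.cos (ray a e ρ).arg) * (‖e‖ * Real.sin e.arg) := by
          rw [Real.sin_sub]; ring
      _ = -(a * e.im) := by
          rw [Complex.norm_mul_sin_arg, Complex.norm_mul_cos_arg, Complex.norm_mul_sin_arg,
            Complex.norm_mul_cos_arg, ray_re, ray_im]
          ring
  have h5 : 0 < a * e.im := by positivity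
  have h6 : 0 ≤ ‖ray a e ρ‖ * ‖e‖ * Real.sin ((ray a e ρ).arg - e.arg) := by positivity
  linarith

lemma le_re_ray_cpow {a : ℝ} (ha : 0 < a) {e : ℂ} (he : ‖e‖ = 1) (hi : 0 < e.im) {β : ℝ}
    (hβ : 0 < β) (hβe : e.arg * β < π / 2) {ρ : ℝ} (hρ : 0 < ρ) :
    (a * e.im) ^ β * Real.cos (e.arg * β) ≤ (ray a e ρ ^ (β : ℂ)).re := by
  rw [Complex.cpow_ofReal_re]
  have h0 : 0 ≤ (ray a e ρ).arg := Complex.arg_nonneg_iff.mpr (by rw [ray_im]; positivity)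
  have h1 : 0 ≤ e.arg := h0.trans (arg_ray_le ha hi hρ)
  have hm : 0 < a * e.im := by positivity
  have hcos : 0 ≤ Real.cos (e.arg * β) :=
    Real.cos_nonneg_of_mem_Icc ⟨by linarith [Real.pi_pos, mul_nonneg h1 hβ.le], hβe.le⟩
  gcongr
  · exact le_norm_ray a he ρ
  · refine Real.cos_le_cos_of_nonneg_of_le_pi (by positivity) (by linarith [Real.pi_pos]) ?_
    gcongr
    exact arg_ray_le ha hi hρ

lemma integral_exp_neg_mul_cos {A : ℂ} (hA : 0 < A.re) (l : ℝ) :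
    ∫ u in Ioi (0 : ℝ), Complex.exp (-(u * A)) * (Real.cos (l * u) : ℂ) = A / (A ^ 2 + l ^ 2) := by
  have h1 : (-A + l * Complex.I).re < 0 := by simpa using hA
  have h2 : (-A - l * Complex.I).re < 0 := by simpa using hA
  have hfun : ∀ u : ℝ, Complex.exp (-(u * A)) * (Real.cos (l * u) : ℂ) =
      1 / 2 * Complex.exp ((-A + l * Complex.I) * u) +
        1 / 2 * Complex.exp ((-A - l * Complex.I) * u) := by
    intro u
    have e1 : (-A + l * Complex.I) * u = -(u * A) + l * u * Complex.I := by ring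
    have e2 : (-A - l * Complex.I) * u = -(u * A) + -(l * u) * Complex.I := by ring
    rw [e1, e2, Complex.exp_add, Complex.exp_add]
    push_cast
    rw [Complex.cos]
    ring
  simp_rw [hfun]
  rw [integral_add ((integrableOn_exp_mul_complex_Ioi h1 0).const_mul _)
    ((integrableOn_exp_mul_complex_Ioi h2 0).const_mul _), integral_const_mul, integral_const_mul,
    integral_exp_mul_complex_Ioi h1, integral_exp_mul_complex_Ioi h2]
  have n1 : -A + l * Complex.I ≠ 0 := fun h => by rw [h] at h1; simp at h1
  have n2 : -A - l * Complex.I ≠ 0 := fun h => by rw [h] at h2; simp at h2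
  have hprod : A ^ 2 + (l : ℂ) ^ 2 = (-A + l * Complex.I) * (-A - l * Complex.I) := by
    linear_combination (l : ℂ) ^ 2 * Complex.I_sq
  rw [hprod]
  simp only [Complex.ofReal_zero, mul_zero, Complex.exp_zero]
  field_simp
  ring

lemma hasSum_complex_exp (z : ℂ) :
    HasSum (fun k : ℕ => z ^ k / (Nat.factorial k : ℂ)) (Complex.exp z) := by
  rw [Complex.exp_eq_exp_ℂ]; exact NormedSpace.expSeries_div_hasSum_exp z

lemma hasSum_real_exp (x : ℝ) :
    HasSum (fun k : ℕ => x ^ k / (Nat.factorial k : ℝ)) (Real.exp x) := by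
  rw [Real.exp_eq_exp_ℝ]; exact NormedSpace.expSeries_div_hasSum_exp x

/-- Contour representation of the Wright function. -/
lemma wright_eq_im {a : ℝ} (ha : 0 < a) {e : ℂ} (he : ‖e‖ = 1) (hi : 0 < e.im) (hr : e.re < 0)
    {β : ℝ} (hβ0 : 0 < β) (hβ1 : β < 1) (u : ℝ) :
    ∑' k : ℕ, (-u) ^ k / ((Nat.factorial k : ℝ) * Real.Gamma (1 - β * (k + 1))) =
      1 / π * ((∫ ρ in Ioi (0 : ℝ), Complex.exp (ray a e ρ) * ray a e ρ ^ ((β - 1 : ℝ) : ℂ) *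
        Complex.exp (-(u * ray a e ρ ^ (β : ℂ)))) * e).im := by
  have hterm : ∀ k : ℕ, ∀ ρ ∈ Ioi (0 : ℝ),
      ((-u : ℂ) ^ k / (Nat.factorial k : ℂ)) * (Complex.exp (ray a e ρ) *
        ray a e ρ ^ ((β * (k + 1) - 1 : ℝ) : ℂ)) =
      Complex.exp (ray a e ρ) * ray a e ρ ^ ((β - 1 : ℝ) : ℂ) *
        ((-(u * ray a e ρ ^ (β : ℂ))) ^ k / (Nat.factorial k : ℂ)) := by
    intro k ρ hρ
    have hne := Complex.slitPlane_ne_zero (ray_mem_slitPlane ha hi (le_of_lt (mem_Ioi.mp hρ)))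
    have : ((β * (k + 1) - 1 : ℝ) : ℂ) = ((β - 1 : ℝ) : ℂ) + (k : ℂ) * (β : ℂ) := by
      push_cast; ring
    rw [this, Complex.cpow_add _ _ hne, Complex.cpow_nat_mul]
    rw [← neg_mul, mul_pow]
    ring
  obtain ⟨K, hK0, hK⟩ := exists_norm_exp_mul_ray_cpow_le ha he hi hr (β - 1)
  have hε : 0 < -e.re / 4 / (|u| + 1) := div_pos (by linarith) (by positivity)
  obtain ⟨L, hL⟩ := exists_rpow_le_add_mul hβ0 hβ1 hε
  have hgrow : ∀ ρ : ℝ, 0 ≤ ρ → |u| * ‖ray a e ρ‖ ^ β ≤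
      (|u| * L + -e.re / 4 * a) + -e.re / 4 * ρ := by
    intro ρ hρ
    have h1 := hL _ (norm_nonneg (ray a e ρ))
    have h2 := norm_ray_le ha.le he.le hρ
    have h3 : |u| * (-e.re / 4 / (|u| + 1)) ≤ -e.re / 4 := by
      rw [mul_div_assoc', div_le_iff₀ (by positivity)]
      nlinarith [abs_nonneg u]
    calc |u| * ‖ray a e ρ‖ ^ β ≤ |u| * (L + -e.re / 4 / (|u| + 1) * ‖ray a e ρ‖) := by gcongr
      _ = |u| * L + |u| * (-e.re / 4 / (|u| + 1)) * ‖ray a e ρ‖ := by ring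
      _ ≤ |u| * L + -e.re / 4 * (a + ρ) := by
          gcongr; linarith
      _ = _ := by ring
  have hsum : HasSum (fun k : ℕ => ∫ ρ in Ioi (0 : ℝ), ((-u : ℂ) ^ k / (Nat.factorial k : ℂ)) *
      (Complex.exp (ray a e ρ) * ray a e ρ ^ ((β * (k + 1) - 1 : ℝ) : ℂ)))
      (∫ ρ in Ioi (0 : ℝ), Complex.exp (ray a e ρ) * ray a e ρ ^ ((β - 1 : ℝ) : ℂ) *
        Complex.exp (-(u * ray a e ρ ^ (β : ℂ)))) := by
    have hb : ∀ ρ : ℝ, HasSum (fun k : ℕ => ‖Complex.exp (ray a e ρ)‖ * ‖ray a e ρ‖ ^ (β - 1) *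
        ((|u| * ‖ray a e ρ‖ ^ β) ^ k / (Nat.factorial k : ℝ)))
        (‖Complex.exp (ray a e ρ)‖ * ‖ray a e ρ‖ ^ (β - 1) *
          Real.exp (|u| * ‖ray a e ρ‖ ^ β)) := fun ρ => (hasSum_real_exp _).mul_left _
    refine hasSum_integral_of_dominated_convergence (fun k ρ => ‖Complex.exp (ray a e ρ)‖ *
      ‖ray a e ρ‖ ^ (β - 1) * ((|u| * ‖ray a e ρ‖ ^ β) ^ k / (Nat.factorial k : ℝ)))
      (fun k => ((integrableOn_exp_mul_ray_cpow ha he hi hr _).const_mul _).1) (fun k => ?_)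
      (Eventually.of_forall fun ρ => (hb ρ).summable) ?_ ?_
    · filter_upwards [ae_restrict_mem measurableSet_Ioi] with ρ hρ
      rw [hterm k ρ hρ]
      simp only [norm_mul, norm_div, norm_pow, norm_neg, Complex.norm_cpow_real,
        Complex.norm_real, Real.norm_eq_abs, Complex.norm_natCast, le_refl]
    · simp_rw [fun ρ => (hb ρ).tsum_eq]
      refine Integrable.mono' ((integrableOn_exp_mul_Ioi (a := e.re / 4) (by linarith) 0).const_mul
        (K * Real.exp (|u| * L + -e.re / 4 * a)))
        (ContinuousOn.aestronglyMeasurable ?_ measurableSet_Ioi) ?_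
      · have hc : ∀ p : ℝ, ContinuousOn (fun ρ => ‖ray a e ρ‖ ^ p) (Ioi 0) := fun p => by
          simpa only [Complex.norm_cpow_real] using!
            ((continuousOn_ray_cpow ha hi (p : ℂ)).mono Ioi_subset_Ici_self).norm
        exact (((Complex.continuous_exp.comp (continuous_ray a e)).norm.continuousOn.mul
          (hc _)).mul (Real.continuous_exp.comp_continuousOn (continuousOn_const.mul (hc _))))
      · filter_upwards [ae_restrict_mem measurableSet_Ioi] with ρ hρ
        have hρ' : 0 ≤ ρ := le_of_lt hρ
        rw [Real.norm_of_nonneg (by positivity)]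
        calc _ ≤ (K * Real.exp (e.re / 2 * ρ)) *
              Real.exp ((|u| * L + -e.re / 4 * a) + -e.re / 4 * ρ) := by
              exact mul_le_mul (hK ρ hρ') (Real.exp_le_exp.mpr (hgrow ρ hρ'))
                (by positivity) (by positivity)
          _ = K * Real.exp (|u| * L + -e.re / 4 * a) *
              (Real.exp (e.re / 2 * ρ) * Real.exp (-e.re / 4 * ρ)) := by
              rw [Real.exp_add]; ring
          _ = _ := by rw [← Real.exp_add]; congr 2; ring
    · filter_upwards [ae_restrict_mem measurableSet_Ioi] with ρ hρ
      simp_rw [fun k => hterm k ρ hρ]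
      exact (hasSum_complex_exp _).mul_left _
  have him := (Complex.hasSum_im (hsum.mul_right e)).mul_left (1 / π)
  rw [← him.tsum_eq]
  refine tsum_congr fun k => ?_
  have h1 := im_hankelRay ha he hi hr (β * (k + 1) - 1)
  have h2 : ((-u : ℂ) ^ k / (Nat.factorial k : ℂ)) =
      (((-u) ^ k / (Nat.factorial k : ℝ) : ℝ) : ℂ) := by push_cast; rfl
  rw [integral_const_mul, mul_assoc]
  change _ = 1 / π * ((-u : ℂ) ^ k / (Nat.factorial k : ℂ) * hankelRay a e _).im
  rw [h2, Complex.im_ofReal_mul, h1, neg_sub]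
  field_simp

/-- The contour integral obtained from the cosine transform, expanded in powers of the frequency. -/
lemma hasSum_hankelRay_cos {a : ℝ} (ha : 0 < a) {e : ℂ} (he : ‖e‖ = 1) (hi : 0 < e.im)
    (hr : e.re < 0) {β : ℝ} (hβ0 : 0 < β) {l : ℝ} (hl : |l| < (a * e.im) ^ β) :
    HasSum (fun n : ℕ => ((-(l ^ 2)) ^ n : ℝ) * hankelRay a e (-1 - 2 * n * β))
      ((∫ ρ in Ioi (0 : ℝ), Complex.exp (ray a e ρ) * ray a e ρ ^ ((β - 1 : ℝ) : ℂ) *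
        (ray a e ρ ^ (β : ℂ) / ((ray a e ρ ^ (β : ℂ)) ^ 2 + (l : ℂ) ^ 2))) * e) := by
  have hm : 0 < a * e.im := by positivity
  have hM : 0 < (a * e.im) ^ β := by positivity
  set q : ℝ := (|l| / (a * e.im) ^ β) ^ 2 with hq
  have hq1 : q < 1 := by
    have h0 : 0 ≤ |l| / (a * e.im) ^ β := by positivity
    have h1 : |l| / (a * e.im) ^ β < 1 := (div_lt_one hM).mpr hl
    rw [hq]; nlinarith
  have hratio : ∀ ρ : ℝ, ‖-((l : ℂ) ^ 2 / (ray a e ρ ^ (β : ℂ)) ^ 2)‖ ≤ q := by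
    intro ρ
    rw [norm_neg, norm_div, norm_pow, norm_pow, Complex.norm_real, Complex.norm_cpow_real,
      Real.norm_eq_abs, ← div_pow, hq]
    gcongr
    exact le_norm_ray a he ρ
  have hterm : ∀ n : ℕ, ∀ ρ ∈ Ioi (0 : ℝ),
      (((-(l ^ 2)) ^ n : ℝ) : ℂ) * (Complex.exp (ray a e ρ) *
        ray a e ρ ^ ((-1 - 2 * n * β : ℝ) : ℂ)) =
      (Complex.exp (ray a e ρ) * ray a e ρ ^ ((-1 : ℝ) : ℂ)) *
        (-((l : ℂ) ^ 2 / (ray a e ρ ^ (β : ℂ)) ^ 2)) ^ n := by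
    intro n ρ hρ
    have hne := Complex.slitPlane_ne_zero (ray_mem_slitPlane ha hi (le_of_lt (mem_Ioi.mp hρ)))
    have : ((-1 - 2 * n * β : ℝ) : ℂ) = ((-1 : ℝ) : ℂ) - ((2 * n : ℕ) : ℂ) * (β : ℂ) := by
      push_cast; ring
    rw [this, Complex.cpow_sub _ _ hne, Complex.cpow_nat_mul, pow_mul, ← neg_div, div_pow]
    push_cast
    ring
  have hsum : HasSum (fun n : ℕ => ∫ ρ in Ioi (0 : ℝ), (((-(l ^ 2)) ^ n : ℝ) : ℂ) *
      (Complex.exp (ray a e ρ) * ray a e ρ ^ ((-1 - 2 * n * β : ℝ) : ℂ)))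
      (∫ ρ in Ioi (0 : ℝ), Complex.exp (ray a e ρ) * ray a e ρ ^ ((β - 1 : ℝ) : ℂ) *
        (ray a e ρ ^ (β : ℂ) / ((ray a e ρ ^ (β : ℂ)) ^ 2 + (l : ℂ) ^ 2))) := by
    have hg := hasSum_geometric_of_lt_one (show 0 ≤ q by positivity) hq1
    have hb : ∀ ρ : ℝ, HasSum (fun n : ℕ => ‖Complex.exp (ray a e ρ) *
        ray a e ρ ^ ((-1 : ℝ) : ℂ)‖ * q ^ n)
        (‖Complex.exp (ray a e ρ) * ray a e ρ ^ ((-1 : ℝ) : ℂ)‖ * (1 - q)⁻¹) :=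
      fun ρ => hg.mul_left _
    refine hasSum_integral_of_dominated_convergence (fun n ρ => ‖Complex.exp (ray a e ρ) *
        ray a e ρ ^ ((-1 : ℝ) : ℂ)‖ * q ^ n)
      (fun n => ((integrableOn_exp_mul_ray_cpow ha he hi hr _).const_mul _).1) (fun n => ?_)
      (Eventually.of_forall fun ρ => (hb ρ).summable) ?_ ?_
    · filter_upwards [ae_restrict_mem measurableSet_Ioi] with ρ hρ
      rw [hterm n ρ hρ, norm_mul, norm_pow]
      gcongr
      exact hratio ρ
    · simp_rw [fun ρ => (hb ρ).tsum_eq]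
      exact (integrableOn_exp_mul_ray_cpow ha he hi hr (-1)).norm.mul_const _
    · filter_upwards [ae_restrict_mem measurableSet_Ioi] with ρ hρ
      simp_rw [fun k => hterm k ρ hρ]
      have hne := Complex.slitPlane_ne_zero (ray_mem_slitPlane ha hi (le_of_lt (mem_Ioi.mp hρ)))
      have hA : ray a e ρ ^ (β : ℂ) ≠ 0 := by simp [Complex.cpow_eq_zero_iff, hne]
      have hgeo := (hasSum_geometric_of_norm_lt_one ((hratio ρ).trans_lt hq1)).mul_left
        (Complex.exp (ray a e ρ) * ray a e ρ ^ ((-1 : ℝ) : ℂ))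
      convert! hgeo using 1
      have hsplit : ray a e ρ ^ ((β - 1 : ℝ) : ℂ) =
          ray a e ρ ^ ((-1 : ℝ) : ℂ) * ray a e ρ ^ (β : ℂ) := by
        rw [← Complex.cpow_add _ _ hne]; congr 1; push_cast; ring
      rw [hsplit, sub_neg_eq_add]
      set A := ray a e ρ ^ (β : ℂ)
      have hA2 : A ^ 2 ≠ 0 := pow_ne_zero 2 hA
      have : (1 + (l : ℂ) ^ 2 / A ^ 2)⁻¹ = A ^ 2 / (A ^ 2 + (l : ℂ) ^ 2) := by
        rw [one_add_div hA2, inv_div]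
      rw [this]
      ring
  have h := hsum.mul_right e
  convert! h using 2 with n
  unfold hankelRay
  rw [integral_const_mul]
  ring

/-- The cosine transform of the Wright function, as a contour integral. -/
lemma integral_wright_cos {a : ℝ} (ha : 0 < a) {e : ℂ} (he : ‖e‖ = 1) (hi : 0 < e.im)
    (hr : e.re < 0) {β : ℝ} (hβ0 : 0 < β) (hβe : e.arg * β < π / 2) (l : ℝ) :
    ∫ u in Ioi (0 : ℝ), ((∫ ρ in Ioi (0 : ℝ), Complex.exp (ray a e ρ) *
        ray a e ρ ^ ((β - 1 : ℝ) : ℂ) * Complex.exp (-(u * ray a e ρ ^ (β : ℂ)))) * e).im *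
        Real.cos (l * u) =
      ((∫ ρ in Ioi (0 : ℝ), Complex.exp (ray a e ρ) * ray a e ρ ^ ((β - 1 : ℝ) : ℂ) *
        (ray a e ρ ^ (β : ℂ) / ((ray a e ρ ^ (β : ℂ)) ^ 2 + (l : ℂ) ^ 2))) * e).im := by
  set κ : ℝ := (a * e.im) ^ β * Real.cos (e.arg * β) with hκ
  have hκ0 : 0 < κ := by
    have h1 : 0 ≤ e.arg := Complex.arg_nonneg_iff.mpr hi.le
    have : 0 < Real.cos (e.arg * β) :=
      Real.cos_pos_of_mem_Ioo ⟨by linarith [Real.pi_pos, mul_nonneg h1 hβ0.le], hβe⟩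
    positivity
  set f : ℝ → ℝ → ℂ := fun u ρ => Complex.exp (ray a e ρ) * ray a e ρ ^ ((β - 1 : ℝ) : ℂ) *
    (Complex.exp (-(u * ray a e ρ ^ (β : ℂ))) * (Real.cos (l * u) : ℂ)) with hf
  have hInt : Integrable (Function.uncurry f)
      ((volume.restrict (Ioi (0 : ℝ))).prod (volume.restrict (Ioi (0 : ℝ)))) := by
    have hdom := Integrable.mul_prod
      (integrableOn_exp_mul_Ioi (a := -κ) (by linarith) 0)
      (integrableOn_exp_mul_ray_cpow ha he hi hr (β - 1)).norm
    refine Integrable.mono' hdom ?_ ?_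
    · rw [Measure.prod_restrict]
      refine ContinuousOn.aestronglyMeasurable ?_ (measurableSet_Ioi.prod measurableSet_Ioi)
      have hs : MapsTo (Prod.snd : ℝ × ℝ → ℝ) (Ioi (0 : ℝ) ×ˢ Ioi (0 : ℝ)) (Ici 0) :=
        fun q hq => le_of_lt (mem_Ioi.mp hq.2)
      have c1 := (continuousOn_exp_mul_ray_cpow ha hi ((β - 1 : ℝ) : ℂ)).comp
        continuousOn_snd hs
      have c2 := (continuousOn_ray_cpow ha hi (β : ℂ)).comp continuousOn_snd hs
      have c3 : ContinuousOn (fun q : ℝ × ℝ => (q.1 : ℂ)) (Ioi (0 : ℝ) ×ˢ Ioi (0 : ℝ)) := by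
        fun_prop
      have c4 : ContinuousOn (fun q : ℝ × ℝ => (Real.cos (l * q.1) : ℂ))
        (Ioi (0 : ℝ) ×ˢ Ioi (0 : ℝ)) := by fun_prop
      exact c1.mul ((c3.mul c2).neg.cexp.mul c4)
    · rw [Measure.prod_restrict]
      filter_upwards [ae_restrict_mem (measurableSet_Ioi.prod measurableSet_Ioi)] with q hq
      have hu : 0 < q.1 := hq.1
      have hre := le_re_ray_cpow ha he hi hβ0 hβe (mem_Ioi.mp hq.2)
      rw [← hκ] at hre
      have h1 : ‖Complex.exp (-(q.1 * ray a e q.2 ^ (β : ℂ)))‖ ≤ Real.exp (-κ * q.1) := by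
        rw [Complex.norm_exp, Complex.neg_re, Complex.re_ofReal_mul]
        apply Real.exp_le_exp.mpr
        nlinarith
      have h2 : ‖(Real.cos (l * q.1) : ℂ)‖ ≤ 1 := by
        rw [Complex.norm_real]; exact Real.abs_cos_le_one _
      simp only [Function.uncurry, hf]
      rw [norm_mul, norm_mul (Complex.exp (-_))]
      calc _ ≤ ‖Complex.exp (ray a e q.2) * ray a e q.2 ^ ((β - 1 : ℝ) : ℂ)‖ *
            (Real.exp (-κ * q.1) * 1) := by gcongr
        _ = _ := by ring
  have hswap := integral_integral_swap hInt
  have hR : ∫ ρ in Ioi (0 : ℝ), ∫ u in Ioi (0 : ℝ), f u ρ =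
      ∫ ρ in Ioi (0 : ℝ), Complex.exp (ray a e ρ) * ray a e ρ ^ ((β - 1 : ℝ) : ℂ) *
        (ray a e ρ ^ (β : ℂ) / ((ray a e ρ ^ (β : ℂ)) ^ 2 + (l : ℂ) ^ 2)) := by
    refine setIntegral_congr_fun measurableSet_Ioi fun ρ hρ => ?_
    simp only [hf]
    rw [integral_const_mul, integral_exp_neg_mul_cos
      (hκ0.trans_le (le_re_ray_cpow ha he hi hβ0 hβe hρ))]
  rw [← hR, ← hswap, ← integral_mul_const]
  have hInt' : Integrable (fun u => (∫ ρ in Ioi (0 : ℝ), f u ρ) * e) (volume.restrict (Ioi 0)) :=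
    hInt.integral_prod_left.mul_const e
  rw [← Complex.imCLM_apply, ← Complex.imCLM.integral_comp_comm hInt']
  refine integral_congr_ae (Eventually.of_forall fun u => ?_)
  simp only [hf, Complex.imCLM_apply]
  simp_rw [← mul_assoc]
  rw [integral_mul_const, mul_right_comm, Complex.im_mul_ofReal]

lemma exists_direction {β : ℝ} (hβ0 : 0 < β) (hβ1 : β < 1) :
    ∃ e : ℂ, ‖e‖ = 1 ∧ 0 < e.im ∧ e.re < 0 ∧ e.arg * β < π / 2 := by
  have h0 : π / 2 < π / 2 / β := by
    rw [lt_div_iff₀ hβ0]; nlinarith [Real.pi_pos]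
  obtain ⟨ψ, h1, h2⟩ := exists_between (lt_min (by linarith [Real.pi_pos] : π / 2 < π) h0)
  have hπ := lt_of_lt_of_le h2 (min_le_left _ _)
  have hβ := lt_of_lt_of_le h2 (min_le_right _ _)
  have hpos := Real.pi_pos
  refine ⟨Complex.exp (ψ * Complex.I), Complex.norm_exp_ofReal_mul_I ψ, ?_, ?_, ?_⟩
  · rw [Complex.exp_ofReal_mul_I_im]; exact Real.sin_pos_of_pos_of_lt_pi (by linarith) hπ
  · rw [Complex.exp_ofReal_mul_I_re]; exact Real.cos_neg_of_pi_div_two_lt_of_lt h1 (by linarith)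
  · rw [Complex.exp_mul_I, Complex.arg_cos_add_sin_mul_I ⟨by linarith, hπ.le⟩]
    exact (lt_div_iff₀ hβ0).mp hβ

/-- The cosine transform of the Wright function. -/
lemma integral_wright_mul_cos {β : ℝ} (hβ0 : 0 < β) (hβ1 : β < 1) (l : ℝ) :
    ∫ u in Ioi (0 : ℝ), (∑' k : ℕ, (-u) ^ k /
        ((Nat.factorial k : ℝ) * Real.Gamma (1 - β * (k + 1)))) * Real.cos (l * u) =
      mittagLeffler (2 * β) 1 (-(l ^ 2)) := by
  obtain ⟨e, he, hi, hr, harg⟩ := exists_direction hβ0 hβ1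
  set a : ℝ := (|l| + 1) ^ (1 / β) / e.im with ha_def
  have ha : 0 < a := by positivity
  have hl : |l| < (a * e.im) ^ β := by
    rw [ha_def, div_mul_cancel₀ _ hi.ne', ← Real.rpow_mul (by positivity), one_div,
      inv_mul_cancel₀ hβ0.ne', Real.rpow_one]
    linarith
  simp_rw [wright_eq_im ha he hi hr hβ0 hβ1, mul_assoc (1 / π)]
  rw [integral_const_mul, integral_wright_cos ha he hi hr hβ0 harg]
  have hs := (Complex.hasSum_im (hasSum_hankelRay_cos ha he hi hr hβ0 hl)).mul_left (1 / π)
  rw [← hs.tsum_eq, mittagLeffler]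
  refine tsum_congr fun n => ?_
  rw [Complex.im_ofReal_mul, im_hankelRay ha he hi hr,
    show -(-1 - 2 * (n : ℝ) * β) = 2 * β * n + 1 by ring]
  have := Real.pi_pos.ne'
  field_simp

/-- Wright-type transform of cosine:
`∫_0^∞ g_β(s;t) cos s ds = E_{2β}(−t^{2β}) = ∑ (−1)^n t^{2nβ}/Γ(2nβ+1)`. -/
theorem wrightTransform_cos (β t : ℝ) (hβ0 : 0 < β) (hβ1 : β < 1) (ht : 0 < t) :
    (∫ s in Set.Ioi (0:ℝ), wrightG β s t * Real.cos s)
        = mittagLeffler (2 * β) 1 (-(t ^ (2 * β))) ∧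
      mittagLeffler (2 * β) 1 (-(t ^ (2 * β)))
        = ∑' n : ℕ, (-1 : ℝ) ^ n * t ^ (2 * (n : ℝ) * β) / Real.Gamma (2 * (n : ℝ) * β + 1) := by
  have hl : (t ^ β) ^ 2 = t ^ (2 * β) := by
    rw [← Real.rpow_natCast, ← Real.rpow_mul ht.le]; congr 1; push_cast; ring
  have hb : 0 < t ^ (-β) := by positivity
  constructor
  · rw [← hl, ← integral_wright_mul_cos hβ0 hβ1 (t ^ β)]
    have hsub := integral_comp_mul_left_Ioi (fun u => (∑' k : ℕ, (-u) ^ k /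
      ((Nat.factorial k : ℝ) * Real.Gamma (1 - β * (k + 1)))) * Real.cos (t ^ β * u)) 0 hb
    rw [mul_zero, smul_eq_mul] at hsub
    rw [← (eq_inv_mul_iff_mul_eq₀ hb.ne').mp hsub, ← integral_const_mul]
    refine integral_congr_ae (Eventually.of_forall fun s => ?_)
    have h1 : t ^ β * (t ^ (-β) * s) = s := by
      rw [← mul_assoc, ← Real.rpow_add ht]; simp
    have h2 : -(t ^ (-β) * s) = -s / t ^ β := by
      rw [Real.rpow_neg ht.le]; ring
    simp only [wrightG, h1, h2, mul_assoc]
  · refine tsum_congr fun n => ?_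
    rw [neg_pow, ← Real.rpow_mul_natCast ht.le,
      show 2 * β * (n : ℝ) = 2 * (n : ℝ) * β by ring]
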